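/- Let K be a field of characteristic 0, σ a pointed full-dimensional rational polyhedral cone in N_ℚ, and A = K[σ^∨ ∩ M]. If ∂ is a nonzero homogeneous locally nilpotent derivation on A, then there exist an extremal ray ρ of σ with primitive generator ν, a lattice vector e ∈ S_ρ, and λ ∈ K^* such that ∂(χ^m) = λ⟨m, ν⟩ χ^{m+e} for all m ∈ σ^∨ ∩ M. -/

import Mathlib

open scoped BigOperators Pointwise

noncomputable section

/-- Rational `n`-space `N_ℚ ≅ M_ℚ ≅ ℚⁿ`. -/
abbrev Vec (n : ℕ) := Fin n → ℚ

/-- The natural pairing `M_ℚ × N_ℚ → ℚ`. -/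
def pairQ {n : ℕ} (m p : Vec n) : ℚ := ∑ i, m i * p i

/-- The dual cone of a subset of `N_ℚ`. -/
def dualCone {n : ℕ} (σ : Set (Vec n)) : Set (Vec n) :=
  {m | ∀ p ∈ σ, 0 ≤ pairQ m p}

/-- Inclusion of the lattice `M = ℤⁿ` into `M_ℚ`. -/
def toQ {n : ℕ} (v : Fin n → ℤ) : Vec n := fun i => (v i : ℚ)

/-- A vector of `ℚⁿ` is a lattice vector if all its coordinates are integers. -/
def IsLatticeVec {n : ℕ} (v : Vec n) : Prop := ∀ i, ∃ z : ℤ, v i = (z : ℚ)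

/-- The convex cone generated by a set: all finite nonnegative rational combinations. -/
def coneHull {n : ℕ} (S : Set (Vec n)) : Set (Vec n) :=
  {x | ∃ (G : Finset (Vec n)) (c : Vec n → ℚ), ↑G ⊆ S ∧ (∀ g, 0 ≤ c g) ∧
    x = ∑ g ∈ G, c g • g}

/-- A rational polyhedral cone: the cone generated by finitely many lattice vectors. -/
def IsRatPolyCone {n : ℕ} (σ : Set (Vec n)) : Prop :=
  ∃ G : Finset (Vec n), (∀ g ∈ G, IsLatticeVec g) ∧ σ = coneHull ↑G

/-- A cone is pointed if it contains no line through the origin. -/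
def PointedCone' {n : ℕ} (σ : Set (Vec n)) : Prop := σ ∩ (-σ) ⊆ {0}

/-- A cone is of full dimension if it spans the ambient space. -/
def FullDim {n : ℕ} (σ : Set (Vec n)) : Prop := Submodule.span ℚ σ = ⊤

/-- `ρ` is the extremal ray of `σ` generated by the primitive lattice vector `ν`. -/
def IsExtremalRay {n : ℕ} (σ ρ : Set (Vec n)) (ν : Vec n) : Prop :=
  IsLatticeVec ν ∧ ν ≠ 0 ∧ (∀ c : ℚ, 0 < c → IsLatticeVec (c • ν) → 1 ≤ c) ∧
  ρ = {x | ∃ c : ℚ, 0 ≤ c ∧ x = c • ν} ∧ ρ ⊆ σ ∧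
  (∀ x ∈ σ, ∀ y ∈ σ, x + y ∈ ρ → x ∈ ρ)

/-- The submonoid `σ^∨ ∩ M` of lattice points of the dual cone. -/
def latticeCone {n : ℕ} (σ : Set (Vec n)) : AddSubmonoid (Fin n → ℤ) where
  carrier := {m | toQ m ∈ dualCone σ}
  zero_mem' := by
    intro p hp
    simp [pairQ, toQ]
  add_mem' := by
    intro a b ha hb p hp
    have h : pairQ (toQ (a + b)) p = pairQ (toQ a) p + pairQ (toQ b) p := by
      simp [pairQ, toQ, add_mul, Finset.sum_add_distrib]
    rw [h]
    exact add_nonneg (ha p hp) (hb p hp)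

/-- A derivation is locally nilpotent if every element is annihilated by some iterate. -/
def IsLND {R A : Type*} [CommRing R] [CommRing A] [Algebra R A]
    (D : Derivation R A A) : Prop :=
  ∀ a : A, ∃ k : ℕ, (⇑D)^[k] a = 0

/-- **Farkas' lemma**: a linear functional that is nonnegative wherever finitely many given
functionals are nonnegative is a nonnegative combination of them. -/
theorem exists_nonneg_sum_smul_of_forall_nonneg {k W ι : Type*} [Field k] [LinearOrder k]
    [IsStrictOrderedRing k] [AddCommGroup W] [Module k W] (s : Finset ι) (a : ι → Module.Dual k W)
    (b : Module.Dual k W) (h : ∀ x, (∀ i ∈ s, 0 ≤ a i x) → 0 ≤ b x) :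
    ∃ c : ι → k, (∀ i, 0 ≤ c i) ∧ b = ∑ i ∈ s, c i • a i := by
  classical
  induction s using Finset.induction_on generalizing a b with
  | empty =>
    refine ⟨0, fun _ => le_rfl, LinearMap.ext fun x => ?_⟩
    have h₁ := h x (by simp)
    have h₂ := h (-x) (by simp)
    rw [map_neg] at h₂
    simpa using le_antisymm (by linarith) h₁
  | insert j s hj ih =>
    by_cases hs : ∀ x, (∀ i ∈ s, 0 ≤ a i x) → 0 ≤ b x
    · obtain ⟨c, hc, hb⟩ := ih a b hs
      refine ⟨Function.update c j 0, fun i => ?_, ?_⟩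
      · by_cases hij : i = j
        · simp [hij]
        · simpa [hij] using hc i
      · rw [Finset.sum_insert hj, hb]
        simp only [Function.update_self, zero_smul, zero_add]
        refine Finset.sum_congr rfl fun i hi => ?_
        rw [Function.update_of_ne (ne_of_mem_of_not_mem hi hj)]
    push Not at hs
    obtain ⟨y, hy, hby⟩ := hs
    have hjy : a j y < 0 := by
      by_contra! hjy
      exact hby.not_ge (h y (by simpa using ⟨hjy, hy⟩))
    have hjy' := hjy.ne
    obtain ⟨c, hc, hb⟩ := ih (fun i => a i - (a i y / a j y) • a j) (b - (b y / a j y) • a j) (by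
      intro x hx
      have := h (x - (a j x / a j y) • y) (by
        intro i hi
        rcases Finset.mem_insert.1 hi with rfl | hi
        · simp [hjy']
        · have := hx i hi
          simp only [LinearMap.sub_apply, LinearMap.smul_apply, smul_eq_mul, map_sub,
            map_smul] at this ⊢
          convert this using 2
          ring)
      simp only [LinearMap.sub_apply, LinearMap.smul_apply, smul_eq_mul, map_sub,
        map_smul] at this ⊢
      convert this using 2
      ring)
    have hsum : 0 ≤ b y / a j y - ∑ i ∈ s, c i * (a i y / a j y) := by
      have h₁ : 0 ≤ b y / a j y := div_nonneg_of_nonpos hby.le hjy.le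
      have h₂ : ∑ i ∈ s, c i * (a i y / a j y) ≤ 0 := Finset.sum_nonpos fun i hi =>
        mul_nonpos_of_nonneg_of_nonpos (hc i) (div_nonpos_of_nonneg_of_nonpos (hy i hi) hjy.le)
      linarith
    refine ⟨Function.update c j (b y / a j y - ∑ i ∈ s, c i * (a i y / a j y)), fun i => ?_, ?_⟩
    · by_cases hij : i = j
      · subst hij
        simpa using hsum
      · simpa [hij] using hc i
    · rw [Finset.sum_insert hj, Function.update_self]
      have hcongr : ∑ i ∈ s, Function.update c j
          (b y / a j y - ∑ i ∈ s, c i * (a i y / a j y)) i • a i = ∑ i ∈ s, c i • a i :=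
        Finset.sum_congr rfl fun i hi => by
          rw [Function.update_of_ne (ne_of_mem_of_not_mem hi hj)]
      rw [hcongr]
      refine LinearMap.ext fun x => ?_
      replace hb := LinearMap.congr_fun hb x
      simp only [LinearMap.sub_apply, LinearMap.add_apply, LinearMap.smul_apply,
        LinearMap.sum_apply, smul_eq_mul, mul_sub, Finset.sum_sub_distrib, ← mul_assoc,
        ← Finset.sum_mul] at hb ⊢
      linear_combination hb

section Pairing

variable {n : ℕ}

theorem pairQ_add_left (a b p : Vec n) : pairQ (a + b) p = pairQ a p + pairQ b p :=
  add_dotProduct a b p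

theorem pairQ_add_right (a p q : Vec n) : pairQ a (p + q) = pairQ a p + pairQ a q :=
  dotProduct_add a p q

theorem pairQ_smul_left (c : ℚ) (a p : Vec n) : pairQ (c • a) p = c * pairQ a p :=
  smul_dotProduct c a p

theorem pairQ_smul_right (c : ℚ) (a p : Vec n) : pairQ a (c • p) = c * pairQ a p :=
  dotProduct_smul c a p

theorem pairQ_sum_left {ι : Type*} (s : Finset ι) (f : ι → Vec n) (p : Vec n) :
    pairQ (∑ i ∈ s, f i) p = ∑ i ∈ s, pairQ (f i) p :=
  sum_dotProduct s f p

theorem pairQ_sum_right {ι : Type*} (a : Vec n) (s : Finset ι) (f : ι → Vec n) :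
    pairQ a (∑ i ∈ s, f i) = ∑ i ∈ s, pairQ a (f i) :=
  dotProduct_sum a s f

theorem toQ_add (a b : Fin n → ℤ) : toQ (a + b) = toQ a + toQ b := by
  ext; simp [toQ]

theorem toQ_sub (a b : Fin n → ℤ) : toQ (a - b) = toQ a - toQ b := by
  ext; simp [toQ]

theorem pairQ_sub_left (a b p : Vec n) : pairQ (a - b) p = pairQ a p - pairQ b p :=
  sub_dotProduct a b p

theorem toQ_zsmul (k : ℤ) (a : Fin n → ℤ) : toQ (k • a) = (k : ℚ) • toQ a := by
  ext; simp [toQ]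

theorem toQ_nsmul (k : ℕ) (a : Fin n → ℤ) : toQ (k • a) = (k : ℚ) • toQ a := by
  ext; simp [toQ]

theorem toQ_sum {ι : Type*} (s : Finset ι) (f : ι → Fin n → ℤ) :
    toQ (∑ i ∈ s, f i) = ∑ i ∈ s, toQ (f i) := by
  ext; simp [toQ]

/-- Every rational vector has a positive integer multiple in the lattice. -/
theorem exists_smul_eq_toQ (v : Vec n) : ∃ (N : ℚ) (z : Fin n → ℤ), 0 < N ∧ N • v = toQ z := by
  obtain ⟨b, hb⟩ := IsLocalization.exist_integer_multiples_of_finite (nonZeroDivisors ℤ) v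
  choose z hz using hb
  have hb0 : (b : ℤ) ≠ 0 := nonZeroDivisors.coe_ne_zero b
  refine ⟨(|(b : ℤ)| : ℤ), fun i => SignType.sign (b : ℤ) * z i, by positivity, ?_⟩
  ext i
  have hi : ((z i : ℤ) : ℚ) = (b : ℤ) * v i := by simpa using hz i
  have hs : (((|(b : ℤ)| : ℤ)) : ℚ) = ((SignType.sign (b : ℤ) : ℤ) : ℚ) * ((b : ℤ) : ℚ) := by
    rw [← Int.cast_mul, sign_mul_self]
  simp only [toQ, Pi.smul_apply, smul_eq_mul, Int.cast_mul, hi, hs]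
  ring

/-- Two vectors with the same pairing against all lattice vectors agree. -/
theorem eq_of_forall_pairQ_toQ {p q : Vec n}
    (h : ∀ m : Fin n → ℤ, pairQ (toQ m) p = pairQ (toQ m) q) : p = q := by
  ext i
  have := h (Pi.single i 1)
  simpa [pairQ, toQ, Pi.single_apply] using this

/-- An integral functional is the pairing with the lattice vector of its coordinates. -/
theorem pairQ_toQ_single (d : (Fin n → ℤ) →+ ℤ) (v : Fin n → ℤ) :
    pairQ (toQ v) (toQ fun i => d (Pi.single i 1)) = d v := by
  have h := d.toIntLinearMap.pi_apply_eq_sum_univ v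
  simp only [AddMonoidHom.coe_toIntLinearMap, smul_eq_mul] at h
  have hsingle (i : Fin n) : (fun j => if i = j then (1 : ℤ) else 0) = Pi.single i 1 := by
    ext j
    simp [Pi.single_apply, eq_comm]
  simp [h, hsingle, pairQ, toQ]

end Pairing

section Cone

variable {n : ℕ} {σ : Set (Vec n)}

theorem subset_coneHull (S : Set (Vec n)) : S ⊆ coneHull S := by
  intro g hg
  exact ⟨{g}, fun _ => 1, by simpa using hg, fun _ => zero_le_one, by simp⟩

theorem mem_dualCone_coneHull {S : Set (Vec n)} {m : Vec n} :
    m ∈ dualCone (coneHull S) ↔ ∀ g ∈ S, 0 ≤ pairQ m g := by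
  refine ⟨fun h g hg => h g (subset_coneHull S hg), ?_⟩
  rintro h _ ⟨G, c, hG, hc, rfl⟩
  rw [pairQ_sum_right]
  refine Finset.sum_nonneg fun g hg => ?_
  rw [pairQ_smul_right]
  exact mul_nonneg (hc g) (h g (hG hg))

/-- A rational polyhedral cone is the dual of the lattice points of its dual cone. -/
theorem IsRatPolyCone.mem_of_forall_pairQ_nonneg (hσ : IsRatPolyCone σ) {x : Vec n}
    (hx : ∀ m ∈ latticeCone σ, 0 ≤ pairQ (toQ m) x) : x ∈ σ := by
  obtain ⟨G, -, rfl⟩ := hσ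
  obtain ⟨c, hc, h⟩ := exists_nonneg_sum_smul_of_forall_nonneg G
    (fun g => dotProductEquiv ℚ (Fin n) g) (dotProductEquiv ℚ (Fin n) x) (by
      intro v hv
      obtain ⟨N, z, hN, hz⟩ := exists_smul_eq_toQ v
      have hpair (p : Vec n) : pairQ (toQ z) p = N * dotProductEquiv ℚ (Fin n) p v := by
        rw [← hz, pairQ_smul_left, dotProductEquiv_apply_apply, dotProduct_comm]
        rfl
      have := hx z (mem_dualCone_coneHull.2 fun g hg => by
        rw [hpair]
        exact mul_nonneg hN.le (hv g hg))
      rw [hpair] at this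
      exact nonneg_of_mul_nonneg_right this hN)
  refine ⟨G, c, subset_rfl, hc, (dotProductEquiv ℚ (Fin n)).injective ?_⟩
  rw [h]
  simp

/-- The lattice points of the dual of a pointed rational polyhedral cone generate the lattice. -/
theorem exists_eq_sub_of_pointed (hσ : IsRatPolyCone σ) (hpt : PointedCone' σ) (v : Fin n → ℤ) :
    ∃ a b : latticeCone σ, v = a - b := by
  classical
  obtain ⟨G, hG⟩ : ∃ G : Finset (Vec n), σ = coneHull ↑G := let ⟨G, _, h⟩ := hσ; ⟨G, h⟩
  have hGσ : ∀ g ∈ G, g ∈ σ := fun g hg => hG ▸ subset_coneHull _ hg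
  have key (g : Vec n) (hg : g ∈ σ) : ∃ m ∈ latticeCone σ, 0 ≤ pairQ (toQ (v + m)) g := by
    by_cases hg0 : g = 0
    · exact ⟨0, zero_mem _, by simp [hg0, pairQ]⟩
    have hneg : -g ∉ σ := fun h => hg0 (hpt ⟨hg, h⟩)
    obtain ⟨m, hm, hmg⟩ : ∃ m ∈ latticeCone σ, pairQ (toQ m) (-g) < 0 := by
      by_contra! h
      exact hneg (hσ.mem_of_forall_pairQ_nonneg h)
    rw [← neg_one_smul ℚ g, pairQ_smul_right] at hmg
    obtain ⟨k, hk⟩ := Archimedean.arch (-pairQ (toQ v) g) (show 0 < pairQ (toQ m) g by linarith)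
    refine ⟨k • m, nsmul_mem hm k, ?_⟩
    rw [toQ_add, pairQ_add_left, toQ_nsmul, pairQ_smul_left]
    rw [nsmul_eq_mul] at hk
    linarith
  choose! m hm hmv using key
  have hsum : ∑ g ∈ G, m g ∈ latticeCone σ := sum_mem fun g hg => hm g (hGσ g hg)
  refine ⟨⟨v + ∑ g ∈ G, m g, ?_⟩, ⟨_, hsum⟩, by simp⟩
  change toQ _ ∈ dualCone σ
  rw [hG, mem_dualCone_coneHull]
  intro g hg
  rw [← Finset.add_sum_erase G m hg, ← add_assoc, toQ_add, pairQ_add_left, toQ_sum, pairQ_sum_left]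
  refine add_nonneg (hmv g (hGσ g hg)) (Finset.sum_nonneg fun h hh => ?_)
  exact hm h (hGσ h (Finset.mem_of_mem_erase hh)) g (hGσ g hg)

end Cone

/-- An additive map on a submonoid that generates an abelian group extends to the group. -/
theorem AddSubmonoid.exists_extend_of_forall_eq_sub {G H : Type*} [AddCommGroup G] [AddCommGroup H]
    {L : AddSubmonoid G} (hL : ∀ v : G, ∃ a b : L, v = a - b) (f : L →+ H) :
    ∃ F : G →+ H, ∀ a : L, F a = f a := by
  choose a b hab using hL
  have hwd (x y x' y' : L) (h : (x : G) - y = x' - y') : f x - f y = f x' - f y' := by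
    rw [sub_eq_sub_iff_add_eq_add] at h ⊢
    have : x + y' = x' + y := Subtype.ext (by simpa using h)
    rw [← map_add, this, map_add]
  refine ⟨AddMonoidHom.mk' (fun v => f (a v) - f (b v)) fun v w => ?_, fun x => ?_⟩
  · rw [hwd (a (v + w)) (b (v + w)) (a v + a w) (b v + b w), map_add, map_add]
    · abel
    · rw [← hab, AddSubmonoid.coe_add, AddSubmonoid.coe_add, add_sub_add_comm, ← hab, ← hab]
  · have := hwd (a x) (b x) x 0 (by rw [← hab]; simp)
    simpa using this

namespace AddMonoidAlgebra

variable {K G : Type*} [Field K] [AddCommGroup G] {L : AddSubmonoid G}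

/-- A homogeneous derivation of the algebra of a generating submonoid of an abelian group `G` has
a degree `e` and acts on the monomials through a character `F` of `G`. -/
theorem exists_degree_of_homogeneous (hL : ∀ v : G, ∃ a b : L, v = a - b)
    (D : Derivation K (AddMonoidAlgebra K L) (AddMonoidAlgebra K L))
    (hhom : ∀ m : L, ∃ (m' : L) (c : K), D (single m (1 : K)) = single m' c) :
    ∃ (e : G) (F : G →+ K), (∀ m : L, F m = 0 → D (single m (1 : K)) = 0) ∧
      ∀ m : L, F m ≠ 0 → ∃ m' : L, (m' : G) = m + e ∧ D (single m (1 : K)) = single m' (F m) := by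
  classical
  choose t c hD using hhom
  have hmul (m₁ m₂ : L) : single (t (m₁ + m₂)) (c (m₁ + m₂)) =
      single (m₁ + t m₂) (c m₂) + single (m₂ + t m₁) (c m₁) := by
    have : (single (m₁ + m₂) (1 : K) : AddMonoidAlgebra K L) = single m₁ 1 * single m₂ 1 := by
      simp [single_mul_single]
    rw [← hD, this, D.leibniz, hD, hD]
    simp [single_mul_single]
  let ε : AddMonoidAlgebra K L →ₐ[K] K := lift K K L 1
  have hε (m : L) (r : K) : ε (single m r) = r := by simp [ε, lift_single]
  have hc (m₁ m₂ : L) : c (m₁ + m₂) = c m₁ + c m₂ := by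
    have := congrArg ε (hmul m₁ m₂)
    rw [map_add, hε, hε, hε] at this
    rw [this, add_comm]
  obtain ⟨F, hF⟩ := L.exists_extend_of_forall_eq_sub hL (AddMonoidHom.mk' c hc)
  replace hF : ∀ m : L, F m = c m := hF
  by_cases h0 : ∀ m, c m = 0
  · exact ⟨0, F, fun m _ => by rw [hD, h0, single_zero], fun m hm => absurd (h0 m) (hF m ▸ hm)⟩
  push Not at h0
  obtain ⟨m₁, hm₁⟩ := h0
  refine ⟨t m₁ - m₁, F, fun m hm => by rw [hD, ← hF, hm, single_zero], fun m hm => ?_⟩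
  rw [hF] at hm
  have heq : m₁ + t m = m + t m₁ := by
    by_contra hne
    have h₁ := congrArg (fun x => x.coeff (m₁ + t m)) (hmul m₁ m)
    have h₂ := congrArg (fun x => x.coeff (m + t m₁)) (hmul m₁ m)
    simp only [coeff_add, coeff_single, Finsupp.add_apply, Finsupp.single_apply, hne, Ne.symm hne,
      if_true, if_false, add_zero, zero_add] at h₁ h₂
    split_ifs at h₁ h₂ with h₃ h₄
    · exact hne (h₃.symm.trans h₄)
    all_goals simp_all
  refine ⟨t m, ?_, by rw [hD, hF]⟩
  have := congrArg ((↑) : L → G) heq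
  simp only [AddSubmonoid.coe_add] at this
  rw [← add_sub_assoc, ← this, add_sub_cancel_left]

/-- As long as no factor vanishes, iterating a homogeneous derivation of degree `e` on a monomial
gives a nonzero multiple of a monomial. -/
theorem exists_iterate_single {e : G} {F : G →+ K}
    {D : Derivation K (AddMonoidAlgebra K L) (AddMonoidAlgebra K L)}
    (hD : ∀ m : L, F m ≠ 0 → ∃ m' : L, (m' : G) = m + e ∧ D (single m (1 : K)) = single m' (F m))
    (m : L) (k : ℕ) (hk : ∀ i < k, F m + i • F e ≠ 0) :
    ∃ (m' : L) (r : K), r ≠ 0 ∧ (m' : G) = m + k • e ∧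
      (⇑D)^[k] (single m (1 : K)) = single m' r := by
  induction k with
  | zero => exact ⟨m, 1, one_ne_zero, by simp, rfl⟩
  | succ k ih =>
    obtain ⟨m', r, hr, hm', hDk⟩ := ih fun i hi => hk i (hi.trans k.lt_succ_self)
    have hF : F m' ≠ 0 := by simpa [hm'] using hk k k.lt_succ_self
    obtain ⟨m'', hm'', hDm'⟩ := hD m' hF
    refine ⟨m'', r * F m', mul_ne_zero hr hF, by rw [hm'', hm', succ_nsmul, add_assoc], ?_⟩
    have hsmul : (single m' r : AddMonoidAlgebra K L) = r • single m' 1 := by simp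
    rw [Function.iterate_succ_apply', hDk, hsmul, D.map_smul, hDm', smul_single, smul_eq_mul]

/-- A derivation of a monoid algebra that kills every monomial is zero. -/
theorem derivation_eq_zero_of_single
    {D : Derivation K (AddMonoidAlgebra K L) (AddMonoidAlgebra K L)}
    (hD : ∀ m : L, D (single m (1 : K)) = 0) : D = 0 := by
  ext1 x
  induction x using AddMonoidAlgebra.induction_on with
  | of m => exact hD _
  | add f g hf hg => rw [map_add, hf, hg]; simp
  | smul r f hf => rw [D.map_smul, hf]; simp

end AddMonoidAlgebra

open AddMonoidAlgebra in
/-- Theorem 2.9 (toric classification): every nonzero homogeneous locally nilpotent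
derivation of the affine semigroup algebra `A = K[σ^∨ ∩ M]` is of the form
`λ ∂_{ρ,e}` for an extremal ray `ρ` of `σ` (with primitive generator `ν`), a lattice
vector `e ∈ S_ρ`, and `λ ∈ K^*`; i.e. `∂(χ^m) = λ ⟨m, ν⟩ χ^{m+e}`. -/
theorem stmt8 {n : ℕ} (K : Type*) [Field K] [CharZero K]
    (σ : Set (Vec n))
    (hσ : IsRatPolyCone σ) (hpt : PointedCone' σ) (hfull : FullDim σ)
    (D : Derivation K (AddMonoidAlgebra K ↥(latticeCone σ))
        (AddMonoidAlgebra K ↥(latticeCone σ)))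
    (hDne : D ≠ 0) (hlnd : IsLND D)
    (hhom : ∀ m : latticeCone σ, ∃ (m' : latticeCone σ) (c : K),
      D (single m (1 : K)) = single m' c) :
    ∃ (ρ : Set (Vec n)) (ν : Vec n) (e : Fin n → ℤ) (lam : K),
      lam ≠ 0 ∧ IsExtremalRay σ ρ ν ∧
      toQ e ∉ dualCone σ ∧
      (∀ m : Fin n → ℤ, toQ m ∈ dualCone σ → pairQ (toQ m) ν ≠ 0 →
        toQ (m + e) ∈ dualCone σ) ∧
      (∀ (m m' : latticeCone σ), (m' : Fin n → ℤ) = (m : Fin n → ℤ) + e →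
        D (single m (1 : K)) = (lam * algebraMap ℚ K (pairQ (toQ m) ν)) • single m' (1 : K)) ∧
      (∀ m : latticeCone σ, pairQ (toQ m) ν = 0 → D (single m (1 : K)) = 0) := by
  have hL := exists_eq_sub_of_pointed hσ hpt
  obtain ⟨e, F, hF0, hF1⟩ := exists_degree_of_homogeneous hL D hhom
  have hnil (m : latticeCone σ) : ∃ i : ℕ, F m + i • F e = 0 := by
    by_contra! h
    obtain ⟨k, hk⟩ := hlnd (single m 1)
    obtain ⟨m', r, hr, -, hDk⟩ := exists_iterate_single hF1 m k fun i _ => h i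
    exact hr (single_eq_zero.1 (hDk.symm.trans hk))
  have hFe : F e ≠ 0 := fun h => hDne <| derivation_eq_zero_of_single fun m => hF0 m <| by
    obtain ⟨i, hi⟩ := hnil m
    simpa [h] using hi
  have hint (v : Fin n → ℤ) : ∃ z : ℤ, F v = -(z * F e) := by
    obtain ⟨a, b, rfl⟩ := hL v
    obtain ⟨i, hi⟩ := hnil a
    obtain ⟨j, hj⟩ := hnil b
    refine ⟨i - j, ?_⟩
    rw [nsmul_eq_mul] at hi hj
    rw [map_sub]
    push_cast
    linear_combination hi - hj
  choose z hz using hint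
  have hzuniq {a b : ℤ} (h : (a : K) * F e = b * F e) : a = b :=
    Int.cast_injective (mul_right_cancel₀ hFe h)
  obtain ⟨d, hd⟩ : ∃ d : (Fin n → ℤ) →+ ℤ, ∀ v, F v = -(d v * F e) := by
    refine ⟨AddMonoidHom.mk' z fun v w => hzuniq ?_, hz⟩
    have := hz (v + w)
    rw [map_add, hz v, hz w] at this
    push_cast
    linear_combination this
  have hde : d e = -1 := hzuniq <| by
    push_cast
    linear_combination hd e
  have hdL (m : latticeCone σ) : 0 ≤ d m := by
    obtain ⟨i, hi⟩ := hnil m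
    have : d m = i := hzuniq <| by
      rw [nsmul_eq_mul, hd] at hi
      push_cast
      linear_combination -hi
    omega
  set ν : Vec n := toQ fun i => d (Pi.single i 1)
  have hpair (v : Fin n → ℤ) : pairQ (toQ v) ν = d v := pairQ_toQ_single d v
  have hνσ : ν ∈ σ := hσ.mem_of_forall_pairQ_nonneg fun m hm => by
    rw [hpair]
    exact_mod_cast hdL ⟨m, hm⟩
  have hshift (m : latticeCone σ) : (m : Fin n → ℤ) + d m • e ∈ latticeCone σ := by
    obtain ⟨j, hj⟩ := Int.eq_ofNat_of_zero_le (hdL m)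
    obtain ⟨m', -, -, hm', -⟩ := exists_iterate_single hF1 m j fun i hi h => by
      rw [nsmul_eq_mul, hd m, hj] at h
      have : (i : ℤ) = j := hzuniq <| by
        push_cast at h ⊢
        linear_combination h
      omega
    rw [hj, natCast_zsmul, ← hm']
    exact m'.2
  have hray (x : Vec n) (hx : x ∈ σ) (y : Vec n) (hy : y ∈ σ) (c : ℚ) (hxy : x + y = c • ν)
      (m : latticeCone σ) : pairQ (toQ m) x = -pairQ (toQ e) x * d m := by
    have hsum : pairQ (toQ ((m : Fin n → ℤ) + d m • e)) x +
        pairQ (toQ ((m : Fin n → ℤ) + d m • e)) y = 0 := by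
      rw [← pairQ_add_right, hxy, pairQ_smul_right, hpair, map_add, map_zsmul, hde]
      simp
    have hx0 : pairQ (toQ ((m : Fin n → ℤ) + d m • e)) x = 0 := by
      have := hshift m x hx
      have := hshift m y hy
      linarith
    rw [toQ_add, pairQ_add_left, toQ_zsmul, pairQ_smul_left] at hx0
    linarith
  refine ⟨{x | ∃ c : ℚ, 0 ≤ c ∧ x = c • ν}, ν, e, -F e, neg_ne_zero.2 hFe,
    ⟨fun i => ⟨_, rfl⟩, ?_, ?_, rfl, ?_, ?_⟩, ?_, ?_, ?_, ?_⟩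
  · intro h
    have := hpair e
    simp [h, hde, pairQ] at this
  · intro c hc h
    choose w hw using h
    have hcw : c = (-∑ i, e i * w i : ℤ) := by
      have : pairQ (toQ e) (c • ν) = -c := by simp [pairQ_smul_right, hpair, hde]
      push_cast
      rw [← neg_eq_iff_eq_neg, ← this]
      simp only [pairQ, hw, toQ]
    rw [hcw] at hc ⊢
    exact_mod_cast Int.add_one_le_iff.2 (Int.cast_pos.1 hc)
  · rintro _ ⟨c, hc, rfl⟩
    refine hσ.mem_of_forall_pairQ_nonneg fun m hm => ?_
    rw [pairQ_smul_right]
    exact mul_nonneg hc (hm ν hνσ)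
  · rintro x hx y hy ⟨c, -, hxy⟩
    refine ⟨-pairQ (toQ e) x, ?_, eq_of_forall_pairQ_toQ fun v => ?_⟩
    · obtain ⟨a, b, hab⟩ := hL e
      have hdb : 0 < d b := by
        have := hdL a
        have hdab := congrArg d hab
        rw [hde, map_sub] at hdab
        omega
      refine nonneg_of_mul_nonneg_left ?_ (Int.cast_pos (R := ℚ).2 hdb)
      rw [← hray x hx y hy c hxy b]
      exact b.2 x hx
    · obtain ⟨a, b, rfl⟩ := hL v
      rw [pairQ_smul_right, hpair, toQ_sub, pairQ_sub_left, hray x hx y hy c hxy a,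
        hray x hx y hy c hxy b, map_sub]
      push_cast
      ring
  · intro h
    have := h ν hνσ
    rw [hpair, hde] at this
    norm_num at this
  · intro m hm hmν
    rw [hpair, Int.cast_ne_zero] at hmν
    obtain ⟨m', hm', -⟩ := hF1 ⟨m, hm⟩ (by
      rw [hd]
      exact neg_ne_zero.2 (mul_ne_zero (Int.cast_ne_zero.2 hmν) hFe))
    rw [← hm']
    exact m'.2
  · intro m m' hm'
    have hFm : F m = -F e * algebraMap ℚ K (pairQ (toQ m) ν) := by
      rw [hpair, map_intCast, hd m]
      ring
    rw [← hFm]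
    by_cases h : F m = 0
    · rw [hF0 m h, h, zero_smul]
    · obtain ⟨m'', hm'', hDm⟩ := hF1 m h
      rw [hDm, Subtype.ext (hm''.trans hm'.symm), smul_single, smul_eq_mul, mul_one]
  · intro m hm
    rw [hpair, Int.cast_eq_zero] at hm
    exact hF0 m (by rw [hd, hm]; simp)
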